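/- Let G be a prevariety of group languages over a finite alphabet A and let α : A* → M be a surjective monoid morphism into a finite monoid. Let e ∈ M be idempotent and s, t ∈ M be such that (e,s) is a G-pair for α. Then, for any n ≥ 1 such that m^n is idempotent for every m ∈ M, both e·s and t·(e·s·e·t)^{2n−1} belong to the G-kernel of α. Moreover, every idempotent of M belongs to the G-kernel of α. -/

import Mathlib

/- Common definitions: languages over a finite alphabet, classes of languages,
prevarieties, polynomial closure and its variants, separation, C-pairs, etc. -/

namespace RegLang

variable {A : Type}

/-- A language over the alphabet `A`: a set of finite words. -/
abbrev Lang (A : Type) := Set (FreeMonoid A)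

/-- A class of languages over the alphabet `A`. -/
abbrev LangClass (A : Type) := Set (Lang A)

/-- A lattice of languages: contains `∅` and `A*` and is closed under binary
union and intersection. -/
def IsLatticeClass (C : LangClass A) : Prop :=
  ∅ ∈ C ∧ (Set.univ : Lang A) ∈ C ∧
    (∀ K L : Lang A, K ∈ C → L ∈ C → K ∪ L ∈ C) ∧
    (∀ K L : Lang A, K ∈ C → L ∈ C → K ∩ L ∈ C)

/-- A Boolean algebra of languages: a lattice of languages closed under complement. -/
def IsBooleanAlgebraClass (C : LangClass A) : Prop :=
  IsLatticeClass C ∧ ∀ L ∈ C, Lᶜ ∈ C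

/-- A class is quotient-closed if it is closed under left and right quotients by words. -/
def QuotientClosed (C : LangClass A) : Prop :=
  ∀ L ∈ C, ∀ u : FreeMonoid A,
    {w : FreeMonoid A | u * w ∈ L} ∈ C ∧ {w : FreeMonoid A | w * u ∈ L} ∈ C

/-- A language is regular if it is a preimage of a subset under a monoid morphism
into a finite monoid. -/
def IsRegularLang (L : Lang A) : Prop :=
  ∃ (M : Type) (_ : Monoid M) (_ : Finite M) (φ : FreeMonoid A →* M) (F : Set M),
    L = φ ⁻¹' F

/-- A positive prevariety: a quotient-closed lattice of regular languages. -/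
def IsPositivePrevariety (C : LangClass A) : Prop :=
  IsLatticeClass C ∧ QuotientClosed C ∧ ∀ L ∈ C, IsRegularLang L

/-- A prevariety: a quotient-closed Boolean algebra of regular languages. -/
def IsPrevariety (C : LangClass A) : Prop :=
  IsBooleanAlgebraClass C ∧ QuotientClosed C ∧ ∀ L ∈ C, IsRegularLang L

/-- The marked concatenation `KaL = {uav : u ∈ K, v ∈ L}`. -/
def MarkedCat (K : Lang A) (a : A) (L : Lang A) : Lang A :=
  {w | ∃ u ∈ K, ∃ v ∈ L, w = u * FreeMonoid.of a * v}

/-- A marked concatenation `KaL` is unambiguous if every word of `KaL` has a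
unique factorization `uav` with `u ∈ K` and `v ∈ L`. -/
def Unambiguous (K : Lang A) (a : A) (L : Lang A) : Prop :=
  ∀ u u' v v' : FreeMonoid A, u ∈ K → u' ∈ K → v ∈ L → v' ∈ L →
    u * FreeMonoid.of a * v = u' * FreeMonoid.of a * v' → u = u' ∧ v = v'

/-- The marked concatenation `KaL` is left deterministic: `K ∩ KaA* = ∅`. -/
def LeftDeterministic (K : Lang A) (a : A) (_L : Lang A) : Prop :=
  K ∩ MarkedCat K a Set.univ = ∅

/-- The marked concatenation `KaL` is right deterministic: `L ∩ A*aL = ∅`. -/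
def RightDeterministic (_K : Lang A) (a : A) (L : Lang A) : Prop :=
  L ∩ MarkedCat Set.univ a L = ∅

/-- Polynomial closure: the least class containing `C` and closed under binary
union and marked concatenation. -/
inductive Pol (C : LangClass A) : Lang A → Prop
  | base {L : Lang A} : L ∈ C → Pol C L
  | union {K L : Lang A} : Pol C K → Pol C L → Pol C (K ∪ L)
  | mcat {K L : Lang A} (a : A) : Pol C K → Pol C L → Pol C (MarkedCat K a L)

/-- `coPol C`: the class of complements of languages in `Pol C`. -/
def coPol (C : LangClass A) : LangClass A := {L | ∃ K : Lang A, Pol C K ∧ L = Kᶜ}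

/-- `BPol C`: the least Boolean algebra of languages containing `Pol C`. -/
inductive BPol (C : LangClass A) : Lang A → Prop
  | base {L : Lang A} : Pol C L → BPol C L
  | empty : BPol C ∅
  | univ : BPol C Set.univ
  | union {K L : Lang A} : BPol C K → BPol C L → BPol C (K ∪ L)
  | inter {K L : Lang A} : BPol C K → BPol C L → BPol C (K ∩ L)
  | compl {L : Lang A} : BPol C L → BPol C Lᶜ

/-- Unambiguous polynomial closure: the least class containing `C` and closed
under disjoint union and unambiguous marked concatenation. -/
inductive UPol (C : LangClass A) : Lang A → Prop
  | base {L : Lang A} : L ∈ C → UPol C L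
  | disjUnion {K L : Lang A} : UPol C K → UPol C L → K ∩ L = ∅ → UPol C (K ∪ L)
  | mcat {K L : Lang A} (a : A) : UPol C K → UPol C L → Unambiguous K a L →
      UPol C (MarkedCat K a L)

/-- Alternated polynomial closure: the least class containing `C` and closed under
disjoint union and left- and right-deterministic marked concatenation. -/
inductive APol (C : LangClass A) : Lang A → Prop
  | base {L : Lang A} : L ∈ C → APol C L
  | disjUnion {K L : Lang A} : APol C K → APol C L → K ∩ L = ∅ → APol C (K ∪ L)
  | leftCat {K L : Lang A} (a : A) : APol C K → APol C L → LeftDeterministic K a L →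
      APol C (MarkedCat K a L)
  | rightCat {K L : Lang A} (a : A) : APol C K → APol C L → RightDeterministic K a L →
      APol C (MarkedCat K a L)

/-- `KaL` is left `C`-deterministic: there are `K', L' ∈ C` with `K ⊆ K'`, `L ⊆ L'`
and `K'aL'` left deterministic. -/
def LeftCDeterministic (C : LangClass A) (K : Lang A) (a : A) (L : Lang A) : Prop :=
  ∃ K' ∈ C, ∃ L' ∈ C, K ⊆ K' ∧ L ⊆ L' ∧ LeftDeterministic K' a L'

/-- `KaL` is right `C`-deterministic: there are `K', L' ∈ C` with `K ⊆ K'`, `L ⊆ L'`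
and `K'aL'` right deterministic. -/
def RightCDeterministic (C : LangClass A) (K : Lang A) (a : A) (L : Lang A) : Prop :=
  ∃ K' ∈ C, ∃ L' ∈ C, K ⊆ K' ∧ L ⊆ L' ∧ RightDeterministic K' a L'

/-- Weak alternated polynomial closure: the least class containing `C` and closed under
disjoint union and left- and right-`C`-deterministic marked concatenation. -/
inductive WAPol (C : LangClass A) : Lang A → Prop
  | base {L : Lang A} : L ∈ C → WAPol C L
  | disjUnion {K L : Lang A} : WAPol C K → WAPol C L → K ∩ L = ∅ → WAPol C (K ∪ L)
  | leftCat {K L : Lang A} (a : A) : WAPol C K → WAPol C L →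
      LeftCDeterministic C K a L → WAPol C (MarkedCat K a L)
  | rightCat {K L : Lang A} (a : A) : WAPol C K → WAPol C L →
      RightCDeterministic C K a L → WAPol C (MarkedCat K a L)

/-- `K` separates `L₁` from `L₂`. -/
def Separates (K L₁ L₂ : Lang A) : Prop := L₁ ⊆ K ∧ K ∩ L₂ = ∅

/-- `L₁` is `C`-separable from `L₂`. -/
def Separable (C : LangClass A) (L₁ L₂ : Lang A) : Prop := ∃ K ∈ C, Separates K L₁ L₂

/-- `(s, t)` is a `C`-pair for `φ`: `φ⁻¹(s)` is not `C`-separable from `φ⁻¹(t)`. -/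
def CPair (C : LangClass A) {M : Type} [Monoid M] (φ : FreeMonoid A →* M)
    (s t : M) : Prop :=
  ¬ Separable C (φ ⁻¹' {s}) (φ ⁻¹' {t})

/-- The canonical `C`-preorder on `M` associated with `φ`. -/
def CPreorder (C : LangClass A) {M : Type} [Monoid M] (φ : FreeMonoid A →* M)
    (s t : M) : Prop :=
  ∀ F : Set M, φ ⁻¹' F ∈ C → s ∈ F → t ∈ F

/-- The canonical `C`-equivalence on `M` associated with `φ`. -/
def CEquiv (C : LangClass A) {M : Type} [Monoid M] (φ : FreeMonoid A →* M)
    (s t : M) : Prop :=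
  ∀ F : Set M, φ ⁻¹' F ∈ C → (s ∈ F ↔ t ∈ F)

/-- A `C`-morphism: a surjective morphism all of whose recognized languages are in `C`. -/
def IsCMorphism (C : LangClass A) {N : Type} [Monoid N] (η : FreeMonoid A →* N) : Prop :=
  Function.Surjective η ∧ ∀ F : Set N, η ⁻¹' F ∈ C

/-- `e` is the idempotent power `s^ω` of `s`: an idempotent of the form `s^n`, `n ≥ 1`
(in a finite monoid such an element exists and is unique). -/
def IsIdempotentPower {M : Type} [Monoid M] (s e : M) : Prop :=
  IsIdempotentElem e ∧ ∃ n : ℕ, 1 ≤ n ∧ e = s ^ n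

/-- The `C`-kernel of `φ`: the elements `s` such that `{ε}` is not `C`-separable
from `φ⁻¹(s)`. -/
def gKernel (C : LangClass A) {M : Type} [Monoid M] (φ : FreeMonoid A →* M) : Set M :=
  {s | ¬ Separable C ({1} : Lang A) (φ ⁻¹' {s})}

/-- The strict `C`-kernel of `φ`: the intersection of the `C`-kernel with `φ(A⁺)`. -/
def strictGKernel (C : LangClass A) {M : Type} [Monoid M]
    (φ : FreeMonoid A →* M) : Set M :=
  gKernel C φ ∩ φ '' {w : FreeMonoid A | w ≠ 1}

/-- A group language: one recognized by a morphism into a finite group. -/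
def IsGroupLanguage (L : Lang A) : Prop :=
  ∃ (G : Type) (_ : Group G) (_ : Finite G) (φ : FreeMonoid A →* G) (F : Set G),
    L = φ ⁻¹' F

/-- A prevariety of group languages. -/
def IsGroupPrevariety (G : LangClass A) : Prop :=
  IsPrevariety G ∧ ∀ L ∈ G, IsGroupLanguage L

/-- The well-suited extension `G⁺`: all languages `L ∩ A⁺` and `L ∪ {ε}` for `L ∈ G`. -/
def wellSuited (G : LangClass A) : LangClass A :=
  {L | ∃ K ∈ G, L = K ∩ {w : FreeMonoid A | w ≠ 1} ∨ L = K ∪ ({1} : Lang A)}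

/-- `le` is a partial order on the monoid `N` compatible with multiplication. -/
def IsCompatiblePartialOrder {N : Type} [Monoid N] (le : N → N → Prop) : Prop :=
  (∀ x, le x x) ∧ (∀ x y z, le x y → le y z → le x z) ∧
    (∀ x y, le x y → le y x → x = y) ∧
    (∀ x x' y y', le x y → le x' y' → le (x * x') (y * y'))

/-- `F` is upward closed for the relation `le`. -/
def UpClosed {N : Type} (le : N → N → Prop) (F : Set N) : Prop :=
  ∀ s ∈ F, ∀ t, le s t → t ∈ F

/-- An ordered `C`-morphism: a surjective morphism onto a finite ordered monoid such
that preimages of upward closed sets are in `C`. -/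
def IsOrderedCMorphism (C : LangClass A) {N : Type} [Monoid N]
    (η : FreeMonoid A →* N) (le : N → N → Prop) : Prop :=
  Function.Surjective η ∧ IsCompatiblePartialOrder le ∧
    ∀ F : Set N, UpClosed le F → η ⁻¹' F ∈ C

/-- The syntactic preorder of `L`: `u ≼_L v` iff `xuy ∈ L → xvy ∈ L` for all `x, y`. -/
def SynPre (L : Lang A) (u v : FreeMonoid A) : Prop :=
  ∀ x y : FreeMonoid A, x * u * y ∈ L → x * v * y ∈ L

/-- `φ` is (a copy of) the syntactic morphism of `L`: it is surjective and identifies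
exactly the words that are syntactically congruent for `L`. -/
def IsSyntacticMorphism (L : Lang A) {M : Type} [Monoid M]
    (φ : FreeMonoid A →* M) : Prop :=
  Function.Surjective φ ∧
    ∀ u v : FreeMonoid A, φ u = φ v ↔ ∀ x y : FreeMonoid A, (x * u * y ∈ L ↔ x * v * y ∈ L)

/-- `le` is (a copy of) the syntactic order of `L` on the target of `φ`. -/
def IsSyntacticOrder (L : Lang A) {M : Type} [Monoid M] (φ : FreeMonoid A →* M)
    (le : M → M → Prop) : Prop :=
  ∀ u v : FreeMonoid A, le (φ u) (φ v) ↔ SynPre L u v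

/-- A lattice of languages is closed under finite unions. -/
theorem IsLatticeClass.sUnion_mem {A : Type} {C : LangClass A} (hC : IsLatticeClass C)
    {S : Set (Lang A)} (hS : S.Finite) (h : S ⊆ C) : ⋃₀ S ∈ C := by
  induction S, hS using Set.Finite.induction_on with
  | empty => simpa using hC.1
  | insert _ _ ih =>
    rw [Set.sUnion_insert]
    exact hC.2.2.1 _ _ (h (Set.mem_insert _ _)) (ih fun x hx => h (Set.mem_insert_of_mem _ hx))

/-- A lattice of languages is closed under finite intersections. -/
theorem IsLatticeClass.sInter_mem {A : Type} {C : LangClass A} (hC : IsLatticeClass C)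
    {S : Set (Lang A)} (hS : S.Finite) (h : S ⊆ C) : ⋂₀ S ∈ C := by
  induction S, hS using Set.Finite.induction_on with
  | empty => simpa using hC.2.1
  | insert _ _ ih =>
    rw [Set.sInter_insert]
    exact hC.2.2.2 _ _ (h (Set.mem_insert _ _)) (ih fun x hx => h (Set.mem_insert_of_mem _ hx))

/-- The words that are syntactically congruent to the empty word for `K`. -/
def erasable {A : Type} (K : Lang A) : Lang A :=
  {w | ∀ x y : FreeMonoid A, x * w * y ∈ K ↔ x * y ∈ K}

theorem mul_mem_erasable {A : Type} {K : Lang A} {v w : FreeMonoid A} (hv : v ∈ erasable K)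
    (hw : w ∈ erasable K) : v * w ∈ erasable K := fun x y => by
  rw [← mul_assoc x v w, hw (x * v) y, hv x y]

theorem mem_of_mem_erasable {A : Type} {K : Lang A} {w : FreeMonoid A} (h1 : 1 ∈ K)
    (hw : w ∈ erasable K) : w ∈ K := by
  have h := hw 1 1
  simp only [one_mul, mul_one] at h
  exact h.2 h1

theorem mul_pow_mem_iff_of_mem_erasable {A : Type} {K : Lang A} {w : FreeMonoid A}
    (hw : w ∈ erasable K) (z : FreeMonoid A) (k : ℕ) (x : FreeMonoid A) :
    x * (w * z) ^ k ∈ K ↔ x * z ^ k ∈ K := by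
  induction k generalizing x with
  | zero => simp
  | succ k ih =>
    have h := ih (x * (w * z))
    rw [pow_succ', ← mul_assoc, h, ← mul_assoc x w z, mul_assoc (x * w), hw, pow_succ']

/-- In a prevariety, the class of the empty word in the syntactic congruence
of a member belongs to the prevariety. -/
theorem IsPrevariety.erasable_mem {A : Type} {C : LangClass A} (hC : IsPrevariety C)
    {K : Lang A} (hK : K ∈ C) : erasable K ∈ C := by
  obtain ⟨⟨hlat, hcompl⟩, hquot, hreg⟩ := hC
  obtain ⟨N, _, _, η, F, rfl⟩ := hreg K hK
  let f : N × N → Lang A := fun p => {w | p.1 * η w * p.2 ∈ F ↔ p.1 * p.2 ∈ F}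
  let S : Set (Lang A) := f '' Set.range fun q : FreeMonoid A × FreeMonoid A => (η q.1, η q.2)
  have hS : erasable (η ⁻¹' F) = ⋂₀ S := by
    ext w
    simp only [erasable, S, f, Set.mem_ofPred_eq, Set.sInter_image, Set.mem_iInter,
      Set.forall_mem_range, Set.mem_preimage, map_mul, Prod.forall]
  rw [hS]
  refine hlat.sInter_mem ((Set.toFinite _).image f) ?_
  rintro _ ⟨_, ⟨⟨x, y⟩, rfl⟩, rfl⟩
  have hq : {w : FreeMonoid A | x * w * y ∈ η ⁻¹' F} ∈ C :=
    (hquot _ (hquot _ hK y).2 x).1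
  by_cases hxy : η x * η y ∈ F
  · convert hq using 1
    ext w
    simp [f, hxy]
  · convert hcompl _ hq using 1
    ext w
    simp [f, hxy]

theorem not_separable_iff {A : Type} {C : LangClass A} {L₁ L₂ : Lang A} :
    ¬ Separable C L₁ L₂ ↔ ∀ K ∈ C, L₁ ⊆ K → ∃ w ∈ K, w ∈ L₂ := by
  simp only [Separable, Separates, not_exists, not_and, ← Set.nonempty_iff_ne_empty,
    Set.Nonempty, Set.mem_inter_iff]

theorem mem_gKernel_iff {A : Type} {C : LangClass A} {M : Type} [Monoid M]
    {φ : FreeMonoid A →* M} {m : M} :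
    m ∈ gKernel C φ ↔ ∀ K ∈ C, 1 ∈ K → ∃ w ∈ K, φ w = m := by
  simp [gKernel, not_separable_iff]

theorem idempotent_mem_gKernel {A : Type} {G : LangClass A} (hG : IsGroupPrevariety G)
    {M : Type} [Monoid M] {α : FreeMonoid A →* M} (hsurj : Function.Surjective α) {f : M}
    (hf : IsIdempotentElem f) : f ∈ gKernel G α := by
  rw [mem_gKernel_iff]
  intro K hK h1
  obtain ⟨H, _, _, η, F, rfl⟩ := hG.2 K hK
  obtain ⟨u, rfl⟩ := hsurj f
  refine ⟨u ^ Nat.card H, ?_, ?_⟩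
  · simpa using h1
  · rw [map_pow, hf.pow_eq Nat.card_pos.ne']

theorem mul_mem_gKernel_of_cPair {A : Type} {G : LangClass A} (hG : IsGroupPrevariety G)
    {M : Type} [Monoid M] {α : FreeMonoid A →* M} {e s : M}
    (he : IsIdempotentElem e) (hpair : CPair G α e s) : e * s ∈ gKernel G α := by
  rw [mem_gKernel_iff]
  intro K hK h1
  obtain ⟨H, _, _, η, F, rfl⟩ := hG.2 K hK
  have h1F : (1 : H) ∈ F := by simpa using h1
  -- The exponent `q` is positive and one less than a multiple of the order of `H`.
  obtain ⟨q, hq0, hq⟩ : ∃ q : ℕ, q ≠ 0 ∧ ∀ h : H, h ^ q * h = 1 := by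
    have hpos : 0 < Nat.card H := Nat.card_pos
    refine ⟨2 * Nat.card H - 1, by omega, fun h => ?_⟩
    rw [← pow_succ, Nat.sub_add_cancel (by omega), mul_comm, pow_mul, pow_card_eq_one', one_pow]
  let g : H → Lang A := fun h => {v | h ^ q * η v ∈ F}
  have hmem : ⋃₀ (g '' (η '' (α ⁻¹' {e}))) ∈ G := by
    refine hG.1.1.1.sUnion_mem ((Set.toFinite _).image g) ?_
    rintro _ ⟨_, ⟨u, _, rfl⟩, rfl⟩
    convert (hG.1.2.1 _ hK (u ^ q)).1 using 1
    ext v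
    simp [g]
  obtain ⟨v, ⟨_, ⟨_, ⟨u, hu, rfl⟩, rfl⟩, hv⟩, hvs⟩ :=
    not_separable_iff.1 hpair _ hmem fun u hu =>
      ⟨_, ⟨_, ⟨u, hu, rfl⟩, rfl⟩, by simpa [g, hq] using h1F⟩
  rw [Set.mem_preimage, Set.mem_singleton_iff] at hu hvs
  refine ⟨u ^ q * v, by simpa [g] using hv, ?_⟩
  rw [map_mul, map_pow, hu, hvs, he.pow_eq hq0]

theorem mul_mem_gKernel {A : Type} {G : LangClass A} (hG : IsPrevariety G)
    {M : Type} [Monoid M] {α : FreeMonoid A →* M} {a b : M}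
    (ha : a ∈ gKernel G α) (hb : b ∈ gKernel G α) : a * b ∈ gKernel G α := by
  rw [mem_gKernel_iff] at *
  intro K hK h1
  have h1' : (1 : FreeMonoid A) ∈ erasable K := fun x y => by simp
  obtain ⟨v, hv, rfl⟩ := ha _ (hG.erasable_mem hK) h1'
  obtain ⟨w, hw, rfl⟩ := hb _ (hG.erasable_mem hK) h1'
  exact ⟨v * w, mem_of_mem_erasable h1 (mul_mem_erasable hv hw), map_mul _ _ _⟩

theorem mul_pow_mem_gKernel {A : Type} {G : LangClass A} (hG : IsGroupPrevariety G)
    {M : Type} [Monoid M] {α : FreeMonoid A →* M} (hsurj : Function.Surjective α) {a t : M}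
    (ha : a ∈ gKernel G α) {n : ℕ} (hn : 1 ≤ n) (hidem : IsIdempotentElem ((a * t) ^ n)) :
    t * (a * t) ^ (2 * n - 1) ∈ gKernel G α := by
  rw [mem_gKernel_iff] at *
  intro K hK h1
  obtain ⟨w, hw, rfl⟩ := ha _ (hG.1.erasable_mem hK) fun x y => by simp
  obtain ⟨z, rfl⟩ := hsurj t
  obtain ⟨H, _, _, η, F, rfl⟩ := hG.2 K hK
  obtain ⟨q, hq⟩ : ∃ q, Nat.card H = q + 1 := Nat.exists_eq_succ_of_ne_zero Nat.card_pos.ne'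
  obtain ⟨m, rfl⟩ : ∃ m, n = m + 1 := ⟨n - 1, by omega⟩
  refine ⟨z * (w * z) ^ (m + (m + 1) * (2 * q + 1)), ?_, ?_⟩
  · rw [mul_pow_mem_iff_of_mem_erasable hw, ← pow_succ',
      show m + (m + 1) * (2 * q + 1) + 1 = (q + 1) * (2 * (m + 1)) by ring, ← hq]
    simpa [pow_mul] using h1
  · rw [map_mul, map_pow, map_mul, pow_add, pow_mul, hidem.pow_succ_eq, ← pow_add]
    congr 2
    omega

/-- if `(e, s)` is a `G`-pair with `e` idempotent, then `e·s` and
`t·(e·s·e·t)^{2n−1}` belong to the `G`-kernel (for any `n ≥ 1` making all `n`-th powers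
idempotent); moreover every idempotent belongs to the `G`-kernel. -/
theorem gpair_mem_gKernel {A : Type} [Fintype A] (G : LangClass A)
    (hG : IsGroupPrevariety G) {M : Type} [Monoid M] [Finite M]
    (α : FreeMonoid A →* M) (hsurj : Function.Surjective α)
    (e s t : M) (he : IsIdempotentElem e) (hpair : CPair G α e s) :
    (∀ n : ℕ, 1 ≤ n → (∀ m : M, IsIdempotentElem (m ^ n)) →
        e * s ∈ gKernel G α ∧ t * (e * s * e * t) ^ (2 * n - 1) ∈ gKernel G α) ∧
      (∀ f : M, IsIdempotentElem f → f ∈ gKernel G α) := by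
  refine ⟨fun n hn hidem => ?_, fun f hf => idempotent_mem_gKernel hG hsurj hf⟩
  have hes := mul_mem_gKernel_of_cPair hG he hpair
  exact ⟨hes, mul_pow_mem_gKernel hG hsurj
    (mul_mem_gKernel hG.1 hes (idempotent_mem_gKernel hG hsurj he)) hn (hidem _)⟩

end RegLang
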